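/- Let λ be an intensity vector, t > 0, p ≥ 1 an integer, and h > 0 with hλ_j(1+k̃_j) ≤ 1 for all j; set a = t/(t+h). Then: (i) Ñ_t(λ) = (1/(1−a))·(I − a·P̃^{(h)}(λ)); (ii) Ñ_t(λ) is invertible and the series ∑_{k=0}^∞ C(p+k−1, k)·a^k·(1−a)^p·(P̃^{(h)}(λ))^k converges entrywise with sum (Ñ_t(λ)^{−1})^p, where C(n,k) denotes the binomial coefficient; (iii) every entry of Ñ_t(λ)^{−p} lies in [0,1] and each row of Ñ_t(λ)^{−p} sums to 1; (iv) the top-left M×M block N_t(λ) is invertible, every entry of N_t(λ)^{−p} lies in [0,1], and each row of N_t(λ)^{−p} has sum at most 1. -/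

import Mathlib

noncomputable section

open Finset MeasureTheory

/-- Paper index `j ∈ {1,…,M+1}` as an element of `Fin (M+1)`. -/
def fid (M j : ℕ) : Fin (M + 1) := ⟨(j - 1) % (M + 1), Nat.mod_lt _ (Nat.succ_pos M)⟩

/-- `q_{j,j+1}` built from the grid `i` and the drift `b`. -/
def qup (i b : ℕ → ℝ) (j : ℕ) : ℝ :=
  ((i j - i (j - 1)) / (i (j + 1) - i (j - 1))) * (1 + (i (j + 1) - i j) * b j)

/-- `q_{j,j-1}` built from the grid `i` and the drift `b`. -/
def qdn (i b : ℕ → ℝ) (j : ℕ) : ℝ :=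
  ((i (j + 1) - i j) / (i (j + 1) - i (j - 1))) * (1 - (i j - i (j - 1)) * b j)

/-- `k̃_j = (i_{j+1}-i_j)(i_j-i_{j-1}) k_j` for `2 ≤ j ≤ M-1`, and `0` otherwise. -/
def ktil (M : ℕ) (i k : ℕ → ℝ) (j : ℕ) : ℝ :=
  if 2 ≤ j ∧ j ≤ M - 1 then (i (j + 1) - i j) * (i j - i (j - 1)) * k j else 0

/-- The drift hypothesis `-1/(i_{j+1}-i_j) < b_j < 1/(i_j - i_{j-1})`. -/
def DriftHyp (M : ℕ) (i b : ℕ → ℝ) : Prop :=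
  ∀ j, 2 ≤ j → j ≤ M - 1 →
    -(1 / (i (j + 1) - i j)) < b j ∧ b j < 1 / (i j - i (j - 1))

/-- An intensity vector: nonnegative on `{2,…,M-1}` and (by convention) `0` elsewhere. -/
def IntensityVec (M : ℕ) (lam : ℕ → ℝ) : Prop :=
  (∀ j, 2 ≤ j → j ≤ M - 1 → 0 ≤ lam j) ∧ (∀ j, ¬(2 ≤ j ∧ j ≤ M - 1) → lam j = 0)

/-- `p ∈ 𝕊^M`. -/
def ProbVec (M : ℕ) (p : ℕ → ℝ) : Prop :=
  (∀ j, 1 ≤ j → j ≤ M → 0 < p j) ∧ ∑ j ∈ Finset.Icc 1 M, p j = 1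

/-- `κ` are martingale coordinates for `(i,b)`. -/
def MartCoord (M : ℕ) (i b κ : ℕ → ℝ) : Prop :=
  (∀ j, 1 ≤ j → j ≤ M - 1 → κ j < κ (j + 1)) ∧
  (∀ j, 2 ≤ j → j ≤ M - 1 →
    qup i b j = (κ j - κ (j - 1)) / (κ (j + 1) - κ (j - 1)) ∧
    qdn i b j = (κ (j + 1) - κ j) / (κ (j + 1) - κ (j - 1)))

/-- The point `x₀` of the G-system. -/
def Gx0 (M : ℕ) (s : ℝ) (κ kt P G : ℕ → ℝ) : ℝ :=
  (∑ j ∈ Finset.Icc 1 M, κ j * P j * (1 + s * G j * kt j)) /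
    (∑ j ∈ Finset.Icc 1 M, P j * (1 + s * G j * kt j))

/-- `(G, l)` solves the G-system with time parameter `s` and probability vector `P`. -/
def GSystem (M : ℕ) (s : ℝ) (κ kt P G : ℕ → ℝ) (l : ℕ) : Prop :=
  2 ≤ l ∧ l ≤ M ∧
  (∀ j, 1 ≤ j → j ≤ M → 0 ≤ G j) ∧ G 1 = 0 ∧ G M = 0 ∧
  κ (l - 1) < Gx0 M s κ kt P G ∧ Gx0 M s κ kt P G ≤ κ l ∧
  (∀ j, 2 ≤ j → j ≤ l - 1 →
    G j = (1 / (s * P j)) *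
      ((κ (j + 1) - κ (j - 1)) / ((κ (j + 1) - κ j) * (κ j - κ (j - 1)))) *
      ∑ a ∈ Finset.Icc 1 (j - 1), (κ j - κ a) * P a * (1 + s * G a * kt a)) ∧
  (∀ j, l ≤ j → j ≤ M - 1 →
    G j = (1 / (s * P j)) *
      ((κ (j + 1) - κ (j - 1)) / ((κ (j + 1) - κ j) * (κ j - κ (j - 1)))) *
      ∑ a ∈ Finset.Icc (j + 1) M, (κ a - κ j) * P a * (1 + s * G a * kt a))

/-- Entry `(j,c)` (paper indices in `{1,…,M+1}`) of the matrix `Ñ_t(λ)`. -/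
def NtE (M : ℕ) (t : ℝ) (i b k lam : ℕ → ℝ) (j c : ℕ) : ℝ :=
  if 2 ≤ j ∧ j ≤ M - 1 then
    if c = j then 1 + t * lam j * (1 + ktil M i k j)
    else if c = j + 1 then -(t * lam j * qup i b j)
    else if c = j - 1 then -(t * lam j * qdn i b j)
    else if c = M + 1 then -(t * lam j * ktil M i k j)
    else 0
  else if c = j then 1 else 0

/-- The `(M+1)×(M+1)` matrix `Ñ_t(λ)`. -/
def Ntilde (M : ℕ) (t : ℝ) (i b k lam : ℕ → ℝ) : Matrix (Fin (M + 1)) (Fin (M + 1)) ℝ :=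
  Matrix.of fun u v => NtE M t i b k lam (u.1 + 1) (v.1 + 1)

/-- The top-left `M×M` block `N_t(λ)` of `Ñ_t(λ)`. -/
def NMat (M : ℕ) (t : ℝ) (i b k lam : ℕ → ℝ) : Matrix (Fin M) (Fin M) ℝ :=
  Matrix.of fun u v => NtE M t i b k lam (u.1 + 1) (v.1 + 1)

/-- Entry `(j,c)` (paper indices) of the one-step transition matrix `P̃^{(h)}(λ)`. -/
def PtE (M : ℕ) (h : ℝ) (i b k lam : ℕ → ℝ) (j c : ℕ) : ℝ :=
  if 2 ≤ j ∧ j ≤ M - 1 then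
    if c = j then 1 - h * lam j * (1 + ktil M i k j)
    else if c = j + 1 then h * lam j * qup i b j
    else if c = j - 1 then h * lam j * qdn i b j
    else if c = M + 1 then h * lam j * ktil M i k j
    else 0
  else if c = j then 1 else 0

/-- The `(M+1)×(M+1)` transition matrix `P̃^{(h)}(λ)`. -/
def Ptilde (M : ℕ) (h : ℝ) (i b k lam : ℕ → ℝ) : Matrix (Fin (M + 1)) (Fin (M + 1)) ℝ :=
  Matrix.of fun u v => PtE M h i b k lam (u.1 + 1) (v.1 + 1)

/-- Entry `(j,c)` (paper indices) of the intensity matrix `Θ(λ)`. -/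
def ThE (M : ℕ) (i b k lam : ℕ → ℝ) (j c : ℕ) : ℝ :=
  if 2 ≤ j ∧ j ≤ M - 1 then
    if c = j then -(lam j * (1 + ktil M i k j))
    else if c = j + 1 then lam j * qup i b j
    else if c = j - 1 then lam j * qdn i b j
    else if c = M + 1 then lam j * ktil M i k j
    else 0
  else 0

/-- The `(M+1)×(M+1)` intensity matrix `Θ(λ)`. -/
def Theta (M : ℕ) (i b k lam : ℕ → ℝ) : Matrix (Fin (M + 1)) (Fin (M + 1)) ℝ :=
  Matrix.of fun u v => ThE M i b k lam (u.1 + 1) (v.1 + 1)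


section Substochastic

theorem mulVec_mono_of_nonneg {n : Type*} [Fintype n] {A : Matrix n n ℝ}
    (hA : ∀ u v, 0 ≤ A u v) {x y : n → ℝ}
    (hxy : x ≤ y) : A.mulVec x ≤ A.mulVec y := fun u =>
  Finset.sum_le_sum fun v _ => mul_le_mul_of_nonneg_left (hxy v) (hA u v)

variable {n : Type*} [Fintype n] [DecidableEq n] {P : Matrix n n ℝ} {a : ℝ}

theorem natCast_mul_smul_pow_apply (c m : ℕ) (u v : n) :
    ((c : Matrix n n ℝ) * (a • P) ^ m) u v = c * (a ^ m * (P ^ m) u v) := by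
  rw [← nsmul_eq_mul, smul_pow, Matrix.smul_apply, Matrix.smul_apply, nsmul_eq_mul, smul_eq_mul]

section OpNorm

attribute [local instance] Matrix.linftyOpNormedRing Matrix.linftyOpNormedAlgebra

theorem norm_smul_lt_one_of_substochastic (hP : ∀ u v, 0 ≤ P u v) (hsum : ∀ u, ∑ v, P u v ≤ 1)
    (ha0 : 0 ≤ a) (ha1 : a < 1) : ‖a • P‖ < 1 := by
  have hnorm : ‖P‖₊ ≤ 1 := by
    rw [Matrix.linfty_opNNNorm_def]
    refine Finset.sup_le fun u _ => ?_
    rw [← NNReal.coe_le_coe]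
    push_cast
    simpa only [Real.norm_of_nonneg (hP u _)] using hsum u
  have hnorm' : ‖P‖ ≤ 1 := by exact_mod_cast hnorm
  calc ‖a • P‖ ≤ ‖a‖ * ‖P‖ := norm_smul_le a P
    _ ≤ a * 1 := by
      rw [Real.norm_of_nonneg ha0]
      exact mul_le_mul_of_nonneg_left hnorm' ha0
    _ < 1 := by simpa using ha1

theorem isUnit_one_sub_smul_of_substochastic (hP : ∀ u v, 0 ≤ P u v)
    (hsum : ∀ u, ∑ v, P u v ≤ 1) (ha0 : 0 ≤ a) (ha1 : a < 1) : IsUnit (1 - a • P) :=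
  isUnit_one_sub_of_norm_lt_one (norm_smul_lt_one_of_substochastic hP hsum ha0 ha1)

theorem hasSum_choose_mul_pow_apply_of_substochastic (hP : ∀ u v, 0 ≤ P u v)
    (hsum : ∀ u, ∑ v, P u v ≤ 1) (ha0 : 0 ≤ a) (ha1 : a < 1) (p : ℕ) (u v : n) :
    HasSum (fun m : ℕ => ((m + p).choose p : ℝ) * (a ^ m * (P ^ m) u v))
      (((1 - a • P)⁻¹ ^ (p + 1)) u v) := by
  have key := hasSum_choose_mul_geometric_of_norm_lt_one' p
    (norm_smul_lt_one_of_substochastic hP hsum ha0 ha1)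
  rw [← Matrix.nonsing_inv_eq_ringInverse] at key
  have happ := key.map (Matrix.entryAddMonoidHom ℝ u v)
    (continuous_apply_apply (ρ := fun _ _ : n => ℝ) u v)
  convert! happ using 2 with m
  exact (natCast_mul_smul_pow_apply _ m u v).symm

end OpNorm

theorem isUnit_smul_one_sub_smul (hP : ∀ u v, 0 ≤ P u v) (hsum : ∀ u, ∑ v, P u v ≤ 1)
    (ha0 : 0 ≤ a) (ha1 : a < 1) : IsUnit ((1 / (1 - a)) • (1 - a • P)) := by
  have hc : IsUnit (1 / (1 - a)) := (one_div_pos.2 (sub_pos.2 ha1)).ne'.isUnit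
  obtain ⟨c, hc⟩ := hc
  rw [← hc]
  exact (isUnit_one_sub_smul_of_substochastic hP hsum ha0 ha1).smul c

theorem inv_smul_one_sub_smul (hP : ∀ u v, 0 ≤ P u v) (hsum : ∀ u, ∑ v, P u v ≤ 1)
    (ha0 : 0 ≤ a) (ha1 : a < 1) :
    ((1 / (1 - a)) • (1 - a • P))⁻¹ = (1 - a) • (1 - a • P)⁻¹ := by
  have hdet := (Matrix.isUnit_iff_isUnit_det _).1
    (isUnit_one_sub_smul_of_substochastic hP hsum ha0 ha1)
  refine Matrix.inv_eq_left_inv ?_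
  rw [smul_mul_smul_comm, Matrix.nonsing_inv_mul _ hdet, mul_one_div_cancel (sub_pos.2 ha1).ne',
    one_smul]

theorem hasSum_negBinomial_inv_pow (hP : ∀ u v, 0 ≤ P u v) (hsum : ∀ u, ∑ v, P u v ≤ 1)
    (ha0 : 0 ≤ a) (ha1 : a < 1) {p : ℕ} (hp : 1 ≤ p) (u v : n) :
    HasSum (fun m : ℕ => ((p + m - 1).choose m : ℝ) * a ^ m * (1 - a) ^ p * (P ^ m) u v)
      ((((1 / (1 - a)) • (1 - a • P))⁻¹ ^ p) u v) := by
  obtain ⟨p, rfl⟩ := Nat.exists_eq_add_of_le' hp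
  rw [inv_smul_one_sub_smul hP hsum ha0 ha1, smul_pow, Matrix.smul_apply, smul_eq_mul]
  convert! (hasSum_choose_mul_pow_apply_of_substochastic hP hsum ha0 ha1 p u v).mul_left
    ((1 - a) ^ (p + 1)) using 2 with m
  rw [show p + 1 + m - 1 = m + p by omega, Nat.choose_symm_add]
  ring

theorem pow_apply_nonneg (hP : ∀ u v, 0 ≤ P u v) (m : ℕ) : ∀ u v, 0 ≤ (P ^ m) u v := by
  induction m with
  | zero =>
    intro u v
    rw [pow_zero, Matrix.one_apply]
    split_ifs <;> norm_num
  | succ m ih =>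
    intro u v
    rw [pow_succ, Matrix.mul_apply]
    exact Finset.sum_nonneg fun w _ => mul_nonneg (ih u w) (hP w v)

theorem inv_pow_apply_nonneg (hP : ∀ u v, 0 ≤ P u v) (hsum : ∀ u, ∑ v, P u v ≤ 1)
    (ha0 : 0 ≤ a) (ha1 : a < 1) {p : ℕ} (hp : 1 ≤ p) (u v : n) :
    0 ≤ (((1 / (1 - a)) • (1 - a • P))⁻¹ ^ p) u v :=
  (hasSum_negBinomial_inv_pow hP hsum ha0 ha1 hp u v).nonneg fun m => by
    have := pow_apply_nonneg hP m u v
    have := sub_pos.2 ha1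
    positivity

theorem smul_one_sub_smul_mulVec_one (u : n) :
    (((1 / (1 - a)) • (1 - a • P)).mulVec 1) u = (1 / (1 - a)) * (1 - a * ∑ v, P u v) := by
  simp [Matrix.mulVec, dotProduct, ← Finset.mul_sum, Finset.sum_sub_distrib, Matrix.one_apply]

theorem inv_mulVec_one_le (hP : ∀ u v, 0 ≤ P u v) (hsum : ∀ u, ∑ v, P u v ≤ 1)
    (ha0 : 0 ≤ a) (ha1 : a < 1) :
    (((1 / (1 - a)) • (1 - a • P))⁻¹).mulVec 1 ≤ 1 := by
  have hdet := (Matrix.isUnit_iff_isUnit_det _).1 (isUnit_smul_one_sub_smul hP hsum ha0 ha1)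
  have hone : (1 : n → ℝ) ≤ ((1 / (1 - a)) • (1 - a • P)).mulVec 1 := fun u => by
    rw [smul_one_sub_smul_mulVec_one, Pi.one_apply, one_div, inv_mul_eq_div,
      le_div_iff₀ (sub_pos.2 ha1)]
    nlinarith [hsum u]
  have hnonneg : ∀ u v, 0 ≤ (((1 / (1 - a)) • (1 - a • P))⁻¹) u v := by
    simpa only [pow_one] using inv_pow_apply_nonneg hP hsum ha0 ha1 le_rfl
  have := mulVec_mono_of_nonneg hnonneg hone
  rwa [Matrix.mulVec_mulVec, Matrix.nonsing_inv_mul _ hdet, Matrix.one_mulVec] at this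

theorem sum_inv_pow_le_one (hP : ∀ u v, 0 ≤ P u v) (hsum : ∀ u, ∑ v, P u v ≤ 1)
    (ha0 : 0 ≤ a) (ha1 : a < 1) {p : ℕ} (hp : 1 ≤ p) (u : n) :
    ∑ v, (((1 / (1 - a)) • (1 - a • P))⁻¹ ^ p) u v ≤ 1 := by
  have hle : (((1 / (1 - a)) • (1 - a • P))⁻¹ ^ p).mulVec 1 ≤ 1 := by
    induction p, hp using Nat.le_induction with
    | base => simpa only [pow_one] using inv_mulVec_one_le hP hsum ha0 ha1
    | succ p hp ih =>
      rw [pow_succ, ← Matrix.mulVec_mulVec]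
      exact (mulVec_mono_of_nonneg (inv_pow_apply_nonneg hP hsum ha0 ha1 hp)
        (inv_mulVec_one_le hP hsum ha0 ha1)).trans ih
  simpa only [Matrix.mulVec, dotProduct, Pi.one_apply, mul_one] using hle u

theorem inv_pow_apply_le_one (hP : ∀ u v, 0 ≤ P u v) (hsum : ∀ u, ∑ v, P u v ≤ 1)
    (ha0 : 0 ≤ a) (ha1 : a < 1) {p : ℕ} (hp : 1 ≤ p) (u v : n) :
    (((1 / (1 - a)) • (1 - a • P))⁻¹ ^ p) u v ≤ 1 :=
  (Finset.single_le_sum (fun w _ => inv_pow_apply_nonneg hP hsum ha0 ha1 hp u w)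
    (Finset.mem_univ v)).trans (sum_inv_pow_le_one hP hsum ha0 ha1 hp u)

theorem sum_inv_pow_eq_one (hP : ∀ u v, 0 ≤ P u v) (hsum : ∀ u, ∑ v, P u v = 1)
    (ha0 : 0 ≤ a) (ha1 : a < 1) (p : ℕ) (u : n) :
    ∑ v, (((1 / (1 - a)) • (1 - a • P))⁻¹ ^ p) u v = 1 := by
  have hsum' : ∀ u, ∑ v, P u v ≤ 1 := fun u => (hsum u).le
  have hdet := (Matrix.isUnit_iff_isUnit_det _).1 (isUnit_smul_one_sub_smul hP hsum' ha0 ha1)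
  have hone : ((1 / (1 - a)) • (1 - a • P)).mulVec 1 = 1 := funext fun u => by
    rw [smul_one_sub_smul_mulVec_one, hsum, mul_one, one_div_mul_cancel (sub_pos.2 ha1).ne',
      Pi.one_apply]
  have hinv : (((1 / (1 - a)) • (1 - a • P))⁻¹).mulVec 1 = 1 := by
    conv_lhs => rw [← hone]
    rw [Matrix.mulVec_mulVec, Matrix.nonsing_inv_mul _ hdet, Matrix.one_mulVec]
  refine Matrix.sum_row_of_mem_rowStochastic (R := ℝ) (pow_mem ?_ p) u
  refine Matrix.mem_rowStochastic.2 ⟨?_, hinv⟩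
  simpa only [pow_one] using inv_pow_apply_nonneg hP hsum' ha0 ha1 le_rfl

end Substochastic

section Chain

variable {M : ℕ} {i b k lam : ℕ → ℝ} {h t : ℝ} {j : ℕ}

theorem grid_steps_pos (hi : ∀ j, 1 ≤ j → j ≤ M - 1 → i j < i (j + 1)) (hj : 2 ≤ j)
    (hjM : j ≤ M - 1) : 0 < i (j + 1) - i j ∧ 0 < i j - i (j - 1) := by
  have h1 := hi j (by omega) hjM
  have h2 := hi (j - 1) (by omega) (by omega)
  rw [Nat.sub_add_cancel (by omega)] at h2
  exact ⟨sub_pos.2 h1, sub_pos.2 h2⟩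

theorem qup_add_qdn (hi : ∀ j, 1 ≤ j → j ≤ M - 1 → i j < i (j + 1)) (hj : 2 ≤ j)
    (hjM : j ≤ M - 1) : qup i b j + qdn i b j = 1 := by
  obtain ⟨h1, h2⟩ := grid_steps_pos hi hj hjM
  have : i (j + 1) - i (j - 1) ≠ 0 := by linarith
  unfold qup qdn
  field_simp
  ring

theorem qup_nonneg (hi : ∀ j, 1 ≤ j → j ≤ M - 1 → i j < i (j + 1)) (hb : DriftHyp M i b)
    (hj : 2 ≤ j) (hjM : j ≤ M - 1) : 0 ≤ qup i b j := by
  obtain ⟨h1, h2⟩ := grid_steps_pos hi hj hjM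
  have hbj := (hb j hj hjM).1
  rw [neg_lt, lt_div_iff₀ h1] at hbj
  exact mul_nonneg (div_nonneg h2.le (by linarith)) (by linarith)

theorem qdn_nonneg (hi : ∀ j, 1 ≤ j → j ≤ M - 1 → i j < i (j + 1)) (hb : DriftHyp M i b)
    (hj : 2 ≤ j) (hjM : j ≤ M - 1) : 0 ≤ qdn i b j := by
  obtain ⟨h1, h2⟩ := grid_steps_pos hi hj hjM
  have hbj := (hb j hj hjM).2
  rw [lt_div_iff₀ h2] at hbj
  exact mul_nonneg (div_nonneg h1.le (by linarith)) (by linarith)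

theorem ktil_nonneg (hi : ∀ j, 1 ≤ j → j ≤ M - 1 → i j < i (j + 1))
    (hk : ∀ j, 2 ≤ j → j ≤ M - 1 → 0 ≤ k j) (j : ℕ) : 0 ≤ ktil M i k j := by
  unfold ktil
  split_ifs with hj
  · obtain ⟨h1, h2⟩ := grid_steps_pos hi hj.1 hj.2
    exact mul_nonneg (mul_nonneg h1.le h2.le) (hk j hj.1 hj.2)
  · exact le_rfl

theorem PtE_nonneg (hi : ∀ j, 1 ≤ j → j ≤ M - 1 → i j < i (j + 1)) (hb : DriftHyp M i b)
    (hk : ∀ j, 2 ≤ j → j ≤ M - 1 → 0 ≤ k j) (hlam : IntensityVec M lam) (hh : 0 < h)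
    (hstep : ∀ j, 1 ≤ j → j ≤ M → h * lam j * (1 + ktil M i k j) ≤ 1) (j c : ℕ) :
    0 ≤ PtE M h i b k lam j c := by
  unfold PtE
  by_cases hj : 2 ≤ j ∧ j ≤ M - 1
  · have hl := mul_nonneg hh.le (hlam.1 j hj.1 hj.2)
    have hs := hstep j (by omega) (by omega)
    rw [if_pos hj]
    split_ifs
    · linarith
    · exact mul_nonneg hl (qup_nonneg hi hb hj.1 hj.2)
    · exact mul_nonneg hl (qdn_nonneg hi hb hj.1 hj.2)
    · exact mul_nonneg hl (ktil_nonneg hi hk j)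
    · exact le_rfl
  · rw [if_neg hj]
    split_ifs <;> norm_num

theorem sum_PtE_eq_one (hi : ∀ j, 1 ≤ j → j ≤ M - 1 → i j < i (j + 1)) (hj1 : 1 ≤ j)
    (hjM : j ≤ M + 1) : ∑ c ∈ Finset.Icc 1 (M + 1), PtE M h i b k lam j c = 1 := by
  by_cases hj : 2 ≤ j ∧ j ≤ M - 1
  · have hsplit : ∀ c, PtE M h i b k lam j c =
        (if c = j then 1 - h * lam j * (1 + ktil M i k j) else 0) +
        (if c = j + 1 then h * lam j * qup i b j else 0) +
        (if c = j - 1 then h * lam j * qdn i b j else 0) +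
        (if c = M + 1 then h * lam j * ktil M i k j else 0) := by
      intro c
      unfold PtE
      rw [if_pos hj]
      split_ifs <;> first | omega | ring
    simp only [hsplit, Finset.sum_add_distrib, Finset.sum_ite_eq', Finset.mem_Icc]
    rw [if_pos (by omega), if_pos (by omega), if_pos (by omega), if_pos (by omega)]
    linear_combination h * lam j * qup_add_qdn (b := b) hi hj.1 hj.2
  · simp only [PtE, if_neg hj, Finset.sum_ite_eq', Finset.mem_Icc]
    exact if_pos ⟨hj1, hjM⟩

theorem NtE_eq (ht : 0 < t) (hh : 0 < h) (j c : ℕ) :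
    NtE M t i b k lam j c = (1 / (1 - t / (t + h))) *
      ((if j = c then 1 else 0) - t / (t + h) * PtE M h i b k lam j c) := by
  have hth : t + h ≠ 0 := by positivity
  have hcoef : 1 - t / (t + h) = h / (t + h) := by field_simp; ring
  rw [hcoef]
  unfold NtE PtE
  split_ifs <;> first | omega | (field_simp; ring)

theorem sum_fin_succ_eq_sum_Icc (f : ℕ → ℝ) (N : ℕ) :
    ∑ v : Fin N, f (v.1 + 1) = ∑ c ∈ Finset.Icc 1 N, f c := by
  rw [Fin.sum_univ_eq_sum_range (fun c => f (c + 1)), Finset.range_eq_Ico, Finset.sum_Ico_add' f 0 N 1]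
  rfl

end Chain

/-- With `a = t/(t+h)`: (i) `Ñ_t(λ) = (1/(1-a))(I - a P̃^{(h)}(λ))`;
(ii) `Ñ_t(λ)` is invertible and the negative-binomial series
`∑ₙ C(p+n-1,n) aⁿ (1-a)^p (P̃^{(h)})ⁿ` converges entrywise to `(Ñ_t(λ)^{-1})^p`;
(iii) every entry of `Ñ_t(λ)^{-p}` lies in `[0,1]` and its rows sum to `1`;
(iv) the top-left `M×M` block `N_t(λ)` is invertible, every entry of `N_t(λ)^{-p}` lies
in `[0,1]`, and its row sums are at most `1`. -/
theorem stmt_7 (M : ℕ) (hM : 3 ≤ M) (i b k : ℕ → ℝ)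
    (hi : ∀ j, 1 ≤ j → j ≤ M - 1 → i j < i (j + 1))
    (hb : DriftHyp M i b)
    (hk : ∀ j, 2 ≤ j → j ≤ M - 1 → 0 ≤ k j)
    (lam : ℕ → ℝ) (hlam : IntensityVec M lam)
    (t : ℝ) (ht : 0 < t) (p : ℕ) (hp : 1 ≤ p) (h : ℝ) (hh : 0 < h)
    (hstep : ∀ j, 1 ≤ j → j ≤ M → h * lam j * (1 + ktil M i k j) ≤ 1) :
    Ntilde M t i b k lam
        = (1 / (1 - t / (t + h))) • (1 - (t / (t + h)) • Ptilde M h i b k lam) ∧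
    IsUnit (Ntilde M t i b k lam) ∧
    (∀ u v : Fin (M + 1),
      HasSum
        (fun n : ℕ => (Nat.choose (p + n - 1) n : ℝ) * (t / (t + h)) ^ n *
          (1 - t / (t + h)) ^ p * ((Ptilde M h i b k lam) ^ n) u v)
        (((Ntilde M t i b k lam)⁻¹ ^ p) u v)) ∧
    (∀ u v : Fin (M + 1),
      0 ≤ ((Ntilde M t i b k lam)⁻¹ ^ p) u v ∧ ((Ntilde M t i b k lam)⁻¹ ^ p) u v ≤ 1) ∧
    (∀ u : Fin (M + 1), ∑ v : Fin (M + 1), ((Ntilde M t i b k lam)⁻¹ ^ p) u v = 1) ∧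
    IsUnit (NMat M t i b k lam) ∧
    (∀ u v : Fin M,
      0 ≤ ((NMat M t i b k lam)⁻¹ ^ p) u v ∧ ((NMat M t i b k lam)⁻¹ ^ p) u v ≤ 1) ∧
    (∀ u : Fin M, ∑ v : Fin M, ((NMat M t i b k lam)⁻¹ ^ p) u v ≤ 1) := by
  have ha0 : 0 ≤ t / (t + h) := by positivity
  have ha1 : t / (t + h) < 1 := (div_lt_one (by positivity)).2 (by linarith)
  have hE := PtE_nonneg hi hb hk hlam hh hstep
  have hP : ∀ u v, 0 ≤ Ptilde M h i b k lam u v := fun u v => hE _ _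
  have hsum : ∀ u, ∑ v, Ptilde M h i b k lam u v = 1 := fun u =>
    (sum_fin_succ_eq_sum_Icc (PtE M h i b k lam (u.1 + 1)) (M + 1)).trans
      (sum_PtE_eq_one hi (by omega) (by omega))
  have hsum' : ∀ u, ∑ v, Ptilde M h i b k lam u v ≤ 1 := fun u => (hsum u).le
  have hN : Ntilde M t i b k lam
      = (1 / (1 - t / (t + h))) • (1 - (t / (t + h)) • Ptilde M h i b k lam) := by
    ext u v
    simp only [Ntilde, Ptilde, Matrix.of_apply, Matrix.smul_apply, Matrix.sub_apply,
      Matrix.one_apply, smul_eq_mul, NtE_eq ht hh, Nat.add_right_cancel_iff, Fin.ext_iff]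
  let Q : Matrix (Fin M) (Fin M) ℝ :=
    Matrix.of fun u v => PtE M h i b k lam (u.1 + 1) (v.1 + 1)
  have hQ : ∀ u v, 0 ≤ Q u v := fun u v => hE _ _
  have hQsum : ∀ u, ∑ v, Q u v ≤ 1 := fun u =>
    calc ∑ v, Q u v = ∑ c ∈ Finset.Icc 1 M, PtE M h i b k lam (u.1 + 1) c :=
          sum_fin_succ_eq_sum_Icc (PtE M h i b k lam (u.1 + 1)) M
      _ ≤ ∑ c ∈ Finset.Icc 1 (M + 1), PtE M h i b k lam (u.1 + 1) c :=
          Finset.sum_le_sum_of_subset_of_nonneg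
            (Finset.Icc_subset_Icc_right (Nat.le_succ M)) fun c _ _ => hE _ _
      _ = 1 := sum_PtE_eq_one hi (by omega) (by omega)
  have hNQ : NMat M t i b k lam = (1 / (1 - t / (t + h))) • (1 - (t / (t + h)) • Q) := by
    ext u v
    simp only [NMat, Q, Matrix.of_apply, Matrix.smul_apply, Matrix.sub_apply,
      Matrix.one_apply, smul_eq_mul, NtE_eq ht hh, Nat.add_right_cancel_iff, Fin.ext_iff]
  rw [hN, hNQ]
  exact ⟨rfl, isUnit_smul_one_sub_smul hP hsum' ha0 ha1,
    hasSum_negBinomial_inv_pow hP hsum' ha0 ha1 hp,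
    fun u v => ⟨inv_pow_apply_nonneg hP hsum' ha0 ha1 hp u v,
      inv_pow_apply_le_one hP hsum' ha0 ha1 hp u v⟩,
    sum_inv_pow_eq_one hP hsum ha0 ha1 p,
    isUnit_smul_one_sub_smul hQ hQsum ha0 ha1,
    fun u v => ⟨inv_pow_apply_nonneg hQ hQsum ha0 ha1 hp u v,
      inv_pow_apply_le_one hQ hQsum ha0 ha1 hp u v⟩,
    sum_inv_pow_le_one hQ hQsum ha0 ha1 hp⟩
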